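/- arXiv:2101.02133 — 5 statements merged into one kernel-verified Lean document; each statement's English description precedes it below -/
import Mathlib

section
/- For every permutation σ of {1,…,n} and every bounded function Φ : S^n → ℂ, ⟨T^V(σ) D^V(Φ) Ξ, Ξ⟩ = ∑_{I ∈ S^n : I∘σ = I} Φ(I) ∏_{k=1}^n a(I_k) = ⟨D^V(Φ) T^V(σ) Ξ, Ξ⟩, where the sum over the σ-fixed tuples I converges absolutely. -/
/-!
STATEMENT 5: For every permutation `σ` of `{1,…,n}` and every bounded `Φ : S^n → ℂ`,
`⟨T^V(σ) D^V(Φ) Ξ, Ξ⟩ = ∑_{I : I∘σ = I} Φ(I) ∏_k a(I_k) = ⟨D^V(Φ) T^V(σ) Ξ, Ξ⟩`,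
the sum over σ-fixed tuples converging absolutely.
(Mathlib's inner product is conjugate-linear in the first variable, so the paper's
`⟨A Ξ, Ξ⟩` is rendered as `inner Ξ (A Ξ)`.)
-/

noncomputable section

/-- The set of nonzero integers. -/
abbrev Sz : Type := {i : ℤ // i ≠ 0}

/-- The Hilbert space `ℓ²(S^n × S^n; ℂ)`. -/
abbrev HVW (n : ℕ) : Type := lp (fun _ : (Fin n → Sz) × (Fin n → Sz) => ℂ) 2

/-- Canonical orthonormal basis vectors `e_{I,J}`. -/
def eVW {n : ℕ} (I J : Fin n → Sz) : HVW n := lp.single 2 (I, J) (1 : ℂ)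

/-- The unit vector `Ξ = ∑_I (∏_k a(I_k))^{1/2} e_{I,I}`. -/
def Xi (n : ℕ) (a : Sz → ℝ) : HVW n :=
  ∑' I : Fin n → Sz, (Real.sqrt (∏ k, a (I k)) : ℂ) • eVW I I

/-- The tensor power of a nonnegative summable family is summable. -/
theorem summable_prod_of_hasSum {ι κ : Type*} [Fintype ι] {a : κ → ℝ} {c : ℝ}
    (ha : ∀ i, 0 ≤ a i) (hsum : HasSum a c) :
    Summable (fun I : ι → κ => ∏ k, a (I k)) := by
  classical
  refine summable_of_sum_le (c := ∏ _k : ι, c)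
    (fun I => Finset.prod_nonneg fun k _ => ha (I k)) fun u => ?_
  calc ∑ I ∈ u, ∏ k, a (I k)
      ≤ ∑ I ∈ Fintype.piFinset fun k : ι => u.image fun I => I k, ∏ k, a (I k) := by
        refine Finset.sum_le_sum_of_subset_of_nonneg (fun I hI => ?_)
          fun I _ _ => Finset.prod_nonneg fun k _ => ha (I k)
        exact Fintype.mem_piFinset.2 fun k => Finset.mem_image_of_mem (fun I => I k) hI
    _ = ∏ k : ι, ∑ j ∈ u.image fun I => I k, a j := (Finset.prod_univ_sum _ _).symm
    _ ≤ ∏ _k : ι, c := Finset.prod_le_prod (fun k _ => Finset.sum_nonneg fun j _ => ha j)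
        fun k _ => sum_le_hasSum _ (fun j _ => ha j) hsum

theorem diagonal_injective {X : Type*} : Function.Injective fun x : X => (x, x) :=
  fun _ _ h => congrArg Prod.fst h

/-- The diagonal function `(I, J) ↦ δ_{I,J} √(w I)` is square-summable when `w` is summable. -/
theorem memlp_diagonal_sqrt {X : Type*} [DecidableEq X] {w : X → ℝ} (hw : ∀ x, 0 ≤ w x)
    (hsum : Summable w) :
    Memℓp (fun p : X × X => if p.1 = p.2 then (Real.sqrt (w p.1) : ℂ) else 0) 2 := by
  refine memℓp_gen ?_
  refine (Function.Injective.summable_iff diagonal_injective ?_).1 ?_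
  · rintro ⟨x, y⟩ h
    have hxy : x ≠ y := by
      rintro rfl
      exact h ⟨x, rfl⟩
    simp [hxy]
  · refine hsum.congr fun x => ?_
    simp [Real.sq_sqrt (hw x)]

/-- The coordinates of `Ξ`. -/
theorem Xi_apply (n : ℕ) (a : Sz → ℝ) (ha : ∀ i, 0 ≤ a i) (hsum : HasSum a 1)
    (I J : Fin n → Sz) :
    Xi n a (I, J) = if I = J then (Real.sqrt (∏ k, a (I k)) : ℂ) else 0 := by
  let g : HVW n := ⟨_, memlp_diagonal_sqrt (fun I => Finset.prod_nonneg fun k _ => ha (I k))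
    (summable_prod_of_hasSum (ι := Fin n) ha hsum)⟩
  have hg : HasSum (fun p => lp.single 2 p (g p)) g := lp.hasSum_single (by norm_num) g
  have hdiag := (Function.Injective.hasSum_iff diagonal_injective ?_).2 hg
  · have hXi : Xi n a = g := by
      rw [← hdiag.tsum_eq, Xi]
      refine tsum_congr fun I => ?_
      rw [eVW, ← lp.single_smul]
      simp [g]
    rw [hXi]
  · rintro ⟨I, J⟩ h
    have hIJ : I ≠ J := by
      rintro rfl
      exact h ⟨I, rfl⟩
    simp [g, hIJ]

/-- If the diagonal entry of `F` at `(I, I)` is `Φ(I) √(∏ a(I_k))` for σ-fixed `I` and zero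
otherwise, then `⟨F, Ξ⟩` is the sum of `Φ(I) ∏ a(I_k)` over σ-fixed tuples. -/
theorem inner_Xi_eq_tsum_fixed (n : ℕ) (a : Sz → ℝ) (ha : ∀ i, 0 ≤ a i) (hsum : HasSum a 1)
    (σ : Equiv.Perm (Fin n)) (Φ : (Fin n → Sz) → ℂ) (F : HVW n)
    (hF : ∀ I, F (I, I) = if I ∘ σ = I then Φ I * (Real.sqrt (∏ k, a (I k)) : ℂ) else 0) :
    (inner ℂ (Xi n a) F : ℂ) =
      ∑' I : {I : Fin n → Sz // I ∘ σ = I}, Φ I.1 * ∏ k, ((a (I.1 k) : ℂ)) := by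
  have hinj : Function.Injective
      fun I : {I : Fin n → Sz // I ∘ σ = I} => (I.1, I.1) :=
    diagonal_injective.comp Subtype.val_injective
  rw [lp.inner_eq_tsum, ← hinj.tsum_eq]
  · refine tsum_congr fun I => ?_
    have hsq : (Real.sqrt (∏ k, a (I.1 k)) : ℂ) * (Real.sqrt (∏ k, a (I.1 k)) : ℂ) =
        ∏ k, (a (I.1 k) : ℂ) := by
      rw [← Complex.ofReal_mul, Real.mul_self_sqrt (Finset.prod_nonneg fun k _ => ha (I.1 k)),
        Complex.ofReal_prod]
    rw [hF, Xi_apply n a ha hsum, if_pos rfl, if_pos I.2, RCLike.inner_apply,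
      Complex.conj_ofReal, mul_assoc, hsq]
  · rintro ⟨I, J⟩ h
    by_cases hIJ : I = J
    · subst hIJ
      by_cases hI : I ∘ σ = I
      · exact ⟨⟨I, hI⟩, rfl⟩
      · simp [hF, hI] at h
    · simp [Xi_apply n a ha hsum, hIJ] at h

theorem trace_of_TD (n : ℕ) (a : Sz → ℝ) (ha : ∀ i, 0 ≤ a i) (hsum : HasSum a 1)
    (σ : Equiv.Perm (Fin n)) (Φ : (Fin n → Sz) → ℂ)
    (hΦ : ∃ C : ℝ, ∀ I, ‖Φ I‖ ≤ C)
    (T D : HVW n →L[ℂ] HVW n)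
    (hT : ∀ (f : HVW n) (I J : Fin n → Sz), (T f) (I, J) = f (I ∘ σ, J))
    (hD : ∀ (f : HVW n) (I J : Fin n → Sz), (D f) (I, J) = Φ I * f (I, J)) :
    Summable (fun I : {I : Fin n → Sz // I ∘ σ = I} =>
      ‖Φ I.1 * ∏ k, ((a (I.1 k) : ℂ))‖) ∧
    (inner ℂ (Xi n a) (T (D (Xi n a))) : ℂ) =
      ∑' I : {I : Fin n → Sz // I ∘ σ = I}, Φ I.1 * ∏ k, ((a (I.1 k) : ℂ)) ∧
    (inner ℂ (Xi n a) (D (T (Xi n a))) : ℂ) =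
      ∑' I : {I : Fin n → Sz // I ∘ σ = I}, Φ I.1 * ∏ k, ((a (I.1 k) : ℂ)) := by
  refine ⟨?_, ?_, ?_⟩
  · obtain ⟨C, hC⟩ := hΦ
    refine Summable.of_nonneg_of_le (fun _ => norm_nonneg _) (fun I => ?_)
      (((summable_prod_of_hasSum (ι := Fin n) ha hsum).mul_left C).comp_injective
        (Subtype.val_injective (p := fun I : Fin n → Sz => I ∘ σ = I)))
    have hnorm : ‖∏ k, (a (I.1 k) : ℂ)‖ = ∏ k, a (I.1 k) := by
      rw [← Complex.ofReal_prod,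
        Complex.norm_of_nonneg (Finset.prod_nonneg fun k _ => ha (I.1 k))]
    rw [norm_mul, hnorm]
    exact mul_le_mul_of_nonneg_right (hC I.1) (Finset.prod_nonneg fun k _ => ha (I.1 k))
  · refine inner_Xi_eq_tsum_fixed n a ha hsum σ Φ _ fun I => ?_
    rw [hT, hD, Xi_apply n a ha hsum]
    split_ifs with h
    · rw [h]
    · rw [mul_zero]
  · refine inner_Xi_eq_tsum_fixed n a ha hsum σ Φ _ fun I => ?_
    rw [hD, hT, Xi_apply n a ha hsum]
    split_ifs with h
    · rw [h]
    · rw [mul_zero]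
end
end

section
/- Let 𝒜^V denote the subalgebra of bounded operators on H_n generated by the set {T^V(σ) : σ a permutation of {1,…,n}} ∪ {D^V(Φ) : Φ : S^n → ℂ bounded}. Then for all A, B ∈ 𝒜^V, ⟨A B Ξ, Ξ⟩ = ⟨B A Ξ, Ξ⟩; in other words, the functional A ↦ ⟨A Ξ, Ξ⟩ is a trace on the algebra 𝒜^V. -/
noncomputable section

/-- The coordinates of `Xi`; the first alternative covers a divergent defining series. -/
theorem Xi_eq_zero_or_apply (n : ℕ) (a : Sz → ℝ) :
    Xi n a = 0 ∨ ∀ I J : Fin n → Sz,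
      Xi n a (I, J) = if I = J then (Real.sqrt (∏ k, a (I k)) : ℂ) else 0 := by
  classical
  by_cases hs : Summable fun I : Fin n → Sz => (Real.sqrt (∏ k, a (I k)) : ℂ) • eVW I I
  · right
    intro I J
    have h := (lp.evalCLM ℂ (fun _ : (Fin n → Sz) × (Fin n → Sz) => ℂ) 2 (I, J)).map_tsum hs
    change Xi n a (I, J) = ∑' K : Fin n → Sz,
      ((Real.sqrt (∏ k, a (K k)) : ℂ) • eVW K K : HVW n) (I, J) at h
    rw [h, tsum_eq_single I]
    · by_cases hIJ : I = J
      · subst hIJ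
        rw [if_pos rfl, lp.coeFn_smul, Pi.smul_apply, eVW, lp.single_apply_self, smul_eq_mul,
          mul_one]
      · have hne : (I, J) ≠ (I, I) := fun h => hIJ (Prod.ext_iff.mp h).2.symm
        rw [if_neg hIJ, lp.coeFn_smul, Pi.smul_apply, eVW, lp.single_apply_ne _ _ _ hne, smul_zero]
    · intro K hK
      have hne : (I, J) ≠ (K, K) := fun h => hK (Prod.ext_iff.mp h).1.symm
      rw [lp.coeFn_smul, Pi.smul_apply, eVW, lp.single_apply_ne _ _ _ hne, smul_zero]
  · left
    exact tsum_eq_zero_of_not_summable hs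

theorem Xi_apply_of_ne {n : ℕ} (a : Sz → ℝ) {I J : Fin n → Sz} (h : I ≠ J) :
    Xi n a (I, J) = 0 := by
  rcases Xi_eq_zero_or_apply n a with h0 | h0
  · simp [h0]
  · rw [h0, if_neg h]

theorem Xi_apply_comp_perm {n : ℕ} (a : Sz → ℝ) (σ : Equiv.Perm (Fin n)) (I J : Fin n → Sz) :
    Xi n a (I ∘ σ, J ∘ σ) = Xi n a (I, J) := by
  rcases Xi_eq_zero_or_apply n a with h0 | h0
  · simp [h0]
  · have hprod : ∏ k, a ((I ∘ σ) k) = ∏ k, a (I k) := Equiv.prod_comp σ fun k => a (I k)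
    rw [h0, h0, hprod]
    simp only [σ.surjective.injective_comp_right.eq_iff]

/-- `B` acts on the first index only: it maps columns to columns, linearly and in a way that does
not depend on the second index. -/
def ActsOnColumns {n : ℕ} (B : HVW n →L[ℂ] HVW n) : Prop :=
  ∀ (f g : HVW n) (J J' : Fin n → Sz) (c : ℂ), (∀ I, g (I, J') = c * f (I, J)) →
    ∀ I, (B g) (I, J') = c * (B f) (I, J)

theorem actsOnColumns_of_mem_adjoin {n : ℕ} {s : Set (HVW n →L[ℂ] HVW n)}
    (hs : ∀ A ∈ s, ActsOnColumns A) {B : HVW n →L[ℂ] HVW n} (hB : B ∈ Algebra.adjoin ℂ s) :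
    ActsOnColumns B := by
  induction hB using Algebra.adjoin_induction with
  | mem A hA => exact hs A hA
  | algebraMap r =>
    intro f g J J' c h I
    simp only [Algebra.algebraMap_eq_smul_one, smul_apply,
      one_apply_eq_self, lp.coeFn_smul, Pi.smul_apply, smul_eq_mul, h I]
    ring
  | add A B _ _ hA hB =>
    intro f g J J' c h I
    simp only [add_apply, lp.coeFn_add, Pi.add_apply, hA f g J J' c h I,
      hB f g J J' c h I, mul_add]
  | mul A B _ _ hA hB => exact fun f g J J' c h => hA _ _ J J' c (hB f g J J' c h)

/-- Commuting with a generating set inside a linear functional implies the trace property. -/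
theorem map_mul_comm_of_mem_adjoin {R E M : Type*} [CommSemiring R] [Semiring E] [Algebra R E]
    [AddCommMonoid M] [Module R M] (φ : E →ₗ[R] M) {s : Set E}
    (hs : ∀ x ∈ s, ∀ y ∈ Algebra.adjoin R s, φ (x * y) = φ (y * x))
    {x y : E} (hx : x ∈ Algebra.adjoin R s) (hy : y ∈ Algebra.adjoin R s) :
    φ (x * y) = φ (y * x) := by
  induction hx using Algebra.adjoin_induction generalizing y with
  | mem x hx => exact hs x hx y hy
  | algebraMap r => rw [Algebra.commutes]
  | add u v _ _ hu hv => rw [add_mul, mul_add, map_add, map_add, hu hy, hv hy]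
  | mul u v hu' hv' hu hv =>
    rw [mul_assoc, hu (mul_mem hv' hy), mul_assoc, hv (mul_mem hy hu'), mul_assoc]

/-- The simultaneous action of a permutation on both multi-indices. -/
def indexPerm {n : ℕ} (σ : Equiv.Perm (Fin n)) :
    Equiv.Perm ((Fin n → Sz) × (Fin n → Sz)) :=
  (σ.symm.arrowCongr (Equiv.refl Sz)).prodCongr (σ.symm.arrowCongr (Equiv.refl Sz))

theorem indexPerm_apply {n : ℕ} (σ : Equiv.Perm (Fin n)) (I J : Fin n → Sz) :
    indexPerm σ (I, J) = (I ∘ σ, J ∘ σ) := rfl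

theorem inner_Xi_perm_mul_comm {n : ℕ} (a : Sz → ℝ) (σ : Equiv.Perm (Fin n))
    {U B : HVW n →L[ℂ] HVW n}
    (hU : ∀ (f : HVW n) (I J : Fin n → Sz), (U f) (I, J) = f (I ∘ σ, J))
    (hB : ActsOnColumns B) :
    (inner ℂ (Xi n a) ((U * B) (Xi n a)) : ℂ) = inner ℂ (Xi n a) ((B * U) (Xi n a)) := by
  rw [lp.inner_eq_tsum, lp.inner_eq_tsum, ← (indexPerm σ).tsum_eq fun p =>
    inner ℂ (Xi n a p) ((B * U) (Xi n a) p)]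
  refine tsum_congr fun p => ?_
  obtain ⟨I, J⟩ := p
  rw [indexPerm_apply, Xi_apply_comp_perm, mul_apply_eq_comp,
    mul_apply_eq_comp, hU,
    hB (Xi n a) (U (Xi n a)) J (J ∘ σ) 1 (fun K => by rw [hU, Xi_apply_comp_perm, one_mul]),
    one_mul]

theorem inner_Xi_diagonal_mul_comm {n : ℕ} (a : Sz → ℝ) (Φ : (Fin n → Sz) → ℂ)
    {U B : HVW n →L[ℂ] HVW n}
    (hU : ∀ (f : HVW n) (I J : Fin n → Sz), (U f) (I, J) = Φ I * f (I, J))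
    (hB : ActsOnColumns B) :
    (inner ℂ (Xi n a) ((U * B) (Xi n a)) : ℂ) = inner ℂ (Xi n a) ((B * U) (Xi n a)) := by
  rw [lp.inner_eq_tsum, lp.inner_eq_tsum]
  refine tsum_congr fun p => ?_
  obtain ⟨I, J⟩ := p
  have hcol : ∀ K, U (Xi n a) (K, J) = Φ J * Xi n a (K, J) := by
    intro K
    rw [hU]
    by_cases hKJ : K = J
    · rw [hKJ]
    · simp [Xi_apply_of_ne a hKJ]
  rw [mul_apply_eq_comp, mul_apply_eq_comp, hU, hB _ _ J J _ hcol]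
  by_cases hIJ : I = J
  · rw [hIJ]
  · rw [Xi_apply_of_ne a hIJ, inner_zero_left, inner_zero_left]

/-!
STATEMENT 8: Let `𝒜^V` be the subalgebra of bounded operators on `H_n` generated by the
permutation operators `T^V(σ)` and the diagonal operators `D^V(Φ)` (Φ bounded).  Then
`⟨A B Ξ, Ξ⟩ = ⟨B A Ξ, Ξ⟩` for all `A, B ∈ 𝒜^V`: the functional `A ↦ ⟨A Ξ, Ξ⟩` is a trace.
(Mathlib's inner product is conjugate-linear in the first variable, so the paper's
`⟨A Ξ, Ξ⟩` is rendered as `inner Ξ (A Ξ)`; multiplication of continuous linear maps is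
composition.)
-/

theorem matrix_element_is_trace_on_AV (n : ℕ) (a : Sz → ℝ)
    (ha : ∀ i, 0 ≤ a i) (hsum : HasSum a 1)
    (T : Equiv.Perm (Fin n) → (HVW n →L[ℂ] HVW n))
    (hT : ∀ (σ : Equiv.Perm (Fin n)) (f : HVW n) (I J : Fin n → Sz),
      (T σ f) (I, J) = f (I ∘ σ, J))
    (D : ((Fin n → Sz) → ℂ) → (HVW n →L[ℂ] HVW n))
    (hD : ∀ Φ : (Fin n → Sz) → ℂ, (∃ C : ℝ, ∀ I, ‖Φ I‖ ≤ C) →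
      ∀ (f : HVW n) (I J : Fin n → Sz), (D Φ f) (I, J) = Φ I * f (I, J))
    (A B : HVW n →L[ℂ] HVW n)
    (hA : A ∈ Algebra.adjoin ℂ
      (Set.range T ∪ D '' {Φ | ∃ C : ℝ, ∀ I, ‖Φ I‖ ≤ C}))
    (hB : B ∈ Algebra.adjoin ℂ
      (Set.range T ∪ D '' {Φ | ∃ C : ℝ, ∀ I, ‖Φ I‖ ≤ C})) :
    (inner ℂ (Xi n a) ((A * B) (Xi n a)) : ℂ) = inner ℂ (Xi n a) ((B * A) (Xi n a)) := by
  have hgen : ∀ U ∈ Set.range T ∪ D '' {Φ | ∃ C : ℝ, ∀ I, ‖Φ I‖ ≤ C}, ActsOnColumns U := by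
    rintro U (⟨σ, rfl⟩ | ⟨Φ, hΦ, rfl⟩) f g J J' c h I
    · rw [hT, hT, h]
    · rw [hD Φ hΦ, hD Φ hΦ, h]
      ring
  refine map_mul_comm_of_mem_adjoin
    ((innerSL ℂ (Xi n a)).toLinearMap ∘ₗ
      (ContinuousLinearMap.apply ℂ (HVW n) (Xi n a)).toLinearMap) ?_ hA hB
  rintro U (⟨σ, rfl⟩ | ⟨Φ, hΦ, rfl⟩) V hV
  · exact inner_Xi_perm_mul_comm a σ (hT σ) (actsOnColumns_of_mem_adjoin hgen hV)
  · exact inner_Xi_diagonal_mul_comm a Φ (hD Φ hΦ) (actsOnColumns_of_mem_adjoin hgen hV)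
end
end

section
/- For 2 ≤ m ≤ n, ⟨R^{left}_{m−1} ∘ ⋯ ∘ R^{left}_2 ∘ R^{left}_1 Ξ, Ξ⟩ = ⟨D_{m−1} ∘ ⋯ ∘ D_2 ∘ D_1 Ξ, Ξ⟩; that is, in the matrix element against Ξ, each R-matrix factor in the chain may be replaced by its diagonal part D. -/
noncomputable section

/-- The tuple `I` with its entries at positions `p` and `p'` interchanged. -/
def swapAt {n : ℕ} (I : Fin n → Sz) (p p' : Fin n) : Fin n → Sz :=
  Function.update (Function.update I p (I p')) p' (I p)

/-- The diagonal coefficient `c_q(i,j)`: `−1` if `i = j < 0`, `q` if `i = j > 0`,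
`q − 1` if `i < j`, and `0` if `i > j`. -/
def cq (q : ℝ) (i j : Sz) : ℝ :=
  if (i : ℤ) = (j : ℤ) then (if (i : ℤ) < 0 then -1 else q)
  else if (i : ℤ) < (j : ℤ) then q - 1 else 0

/-- `R` acts on basis vectors `e_{I,J}` by the Kerov R-matrix rules applied to the pair
`(I_k, I_{k+1})` (0-based positions `k`, `k+1`), leaving the other entries of `I` and all
of `J` unchanged. -/
def KerovRuleVW (n : ℕ) (q : ℝ) (k : ℕ) (hk : k + 1 < n)
    (R : HVW n →L[ℂ] HVW n) : Prop :=
  ∀ I J : Fin n → Sz,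
    ((I ⟨k, Nat.lt_of_succ_lt hk⟩ : ℤ) = (I ⟨k + 1, hk⟩ : ℤ) →
      (((I ⟨k, Nat.lt_of_succ_lt hk⟩ : ℤ) < 0 → R (eVW I J) = - eVW I J) ∧
       (0 < (I ⟨k, Nat.lt_of_succ_lt hk⟩ : ℤ) → R (eVW I J) = (q : ℂ) • eVW I J))) ∧
    ((I ⟨k + 1, hk⟩ : ℤ) < (I ⟨k, Nat.lt_of_succ_lt hk⟩ : ℤ) →
      R (eVW I J) = -((Real.sqrt q : ℂ) •
        eVW (swapAt I ⟨k, Nat.lt_of_succ_lt hk⟩ ⟨k + 1, hk⟩) J)) ∧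
    ((I ⟨k, Nat.lt_of_succ_lt hk⟩ : ℤ) < (I ⟨k + 1, hk⟩ : ℤ) →
      R (eVW I J) = -((Real.sqrt q : ℂ) •
        eVW (swapAt I ⟨k, Nat.lt_of_succ_lt hk⟩ ⟨k + 1, hk⟩) J) + ((q : ℂ) - 1) • eVW I J)

/-- `opChain F j = F (j-1) ∘ ⋯ ∘ F 1 ∘ F 0` (and the identity for `j = 0`). -/
def opChain {n : ℕ} (F : ℕ → (HVW n →L[ℂ] HVW n)) : ℕ → (HVW n →L[ℂ] HVW n)
  | 0 => 1
  | j + 1 => F j * opChain F j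

/-- A Kerov operator acts on a basis vector by its diagonal coefficient plus a multiple of the
swapped basis vector, the latter only if the two entries differ. -/
theorem KerovRuleVW.apply_eVW {n : ℕ} {q : ℝ} {k : ℕ} {hk : k + 1 < n}
    {R : HVW n →L[ℂ] HVW n} (hR : KerovRuleVW n q k hk R) (I J : Fin n → Sz) :
    ∃ b : ℂ, (I ⟨k, Nat.lt_of_succ_lt hk⟩ = I ⟨k + 1, hk⟩ → b = 0) ∧
      R (eVW I J) = (cq q (I ⟨k, Nat.lt_of_succ_lt hk⟩) (I ⟨k + 1, hk⟩) : ℂ) • eVW I J +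
        b • eVW (swapAt I ⟨k, Nat.lt_of_succ_lt hk⟩ ⟨k + 1, hk⟩) J := by
  obtain ⟨heq, hgt, hlt⟩ := hR I J
  rcases lt_trichotomy (I ⟨k, Nat.lt_of_succ_lt hk⟩ : ℤ) (I ⟨k + 1, hk⟩ : ℤ) with h | h | h
  · refine ⟨-(Real.sqrt q : ℂ), fun e => absurd (congrArg Subtype.val e) h.ne, ?_⟩
    rw [hlt h, cq, if_neg h.ne, if_pos h]
    push_cast
    rw [neg_smul, add_comm]
  · refine ⟨0, fun _ => rfl, ?_⟩
    rw [cq, if_pos h, zero_smul, add_zero]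
    rcases lt_or_gt_of_ne (I ⟨k, Nat.lt_of_succ_lt hk⟩).2 with hs | hs
    · rw [(heq h).1 hs, if_pos hs]
      simp
    · rw [(heq h).2 hs, if_neg hs.not_gt]
  · refine ⟨-(Real.sqrt q : ℂ), fun e => absurd (congrArg Subtype.val e) h.ne', ?_⟩
    rw [hgt h, cq, if_neg h.ne', if_neg h.not_gt]
    simp

theorem swapAt_apply_left {n : ℕ} (I : Fin n → Sz) {p p' : Fin n} (h : p ≠ p') :
    swapAt I p p' p = I p' := by
  simp [swapAt, Function.update_of_ne h]

theorem swapAt_apply_of_ne {n : ℕ} (I : Fin n → Sz) {p p' r : Fin n} (h : r ≠ p) (h' : r ≠ p') :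
    swapAt I p p' r = I r := by
  simp [swapAt, Function.update_of_ne h, Function.update_of_ne h']

/-- The span of the vectors `e_{K,J}` such that `K` differs from `I` at a position before `j`. -/
def differBefore {n : ℕ} (I J : Fin n → Sz) (j : ℕ) : Submodule ℂ (HVW n) :=
  Submodule.span ℂ {v | ∃ K : Fin n → Sz, (∃ p : Fin n, p.1 < j ∧ K p ≠ I p) ∧ v = eVW K J}

theorem eVW_mem_differBefore {n : ℕ} {I J K : Fin n → Sz} {j : ℕ} (p : Fin n) (hp : p.1 < j)
    (h : K p ≠ I p) : eVW K J ∈ differBefore I J j :=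
  Submodule.subset_span ⟨K, ⟨p, hp, h⟩, rfl⟩

/-- The `k`-th Kerov operator does not touch the positions before `k`. -/
theorem KerovRuleVW.map_differBefore {n : ℕ} {q : ℝ} {k : ℕ} {hk : k + 1 < n}
    {R : HVW n →L[ℂ] HVW n} (hR : KerovRuleVW n q k hk R) (I J : Fin n → Sz) {f : HVW n}
    (hf : f ∈ differBefore I J k) : R f ∈ differBefore I J (k + 1) := by
  suffices differBefore I J k ≤ (differBefore I J (k + 1)).comap R.toLinearMap from this hf
  refine Submodule.span_le.2 ?_
  rintro _ ⟨K, ⟨p, hp, hne⟩, rfl⟩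
  obtain ⟨b, -, hb⟩ := hR.apply_eVW K J
  change R (eVW K J) ∈ differBefore I J (k + 1)
  rw [hb]
  refine add_mem (Submodule.smul_mem _ _ (eVW_mem_differBefore p (by lia) hne))
    (Submodule.smul_mem _ _ (eVW_mem_differBefore p (by lia) ?_))
  rwa [swapAt_apply_of_ne K (Fin.ne_of_val_ne (by simp; lia)) (Fin.ne_of_val_ne (by simp; lia))]

/-- An operator multiplying coordinates by `c` scales each basis vector. -/
theorem diagonal_apply_eVW {n : ℕ} {D : HVW n →L[ℂ] HVW n} {c : (Fin n → Sz) → ℂ}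
    (hD : ∀ (f : HVW n) (I J : Fin n → Sz), (D f) (I, J) = c I * f (I, J))
    (I J : Fin n → Sz) : D (eVW I J) = c I • eVW I J := by
  ext ⟨K, L⟩
  rw [hD, lp.coeFn_smul, Pi.smul_apply, smul_eq_mul]
  by_cases h : K = I
  · rw [h]
  · have : (eVW I J : HVW n) (K, L) = 0 := by
      simp [eVW, lp.single_apply, h]
    rw [this, mul_zero, mul_zero]

/-- On a basis vector, the chain of Kerov operators agrees with the chain of their diagonal parts
up to basis vectors with a different first index. -/
theorem opChain_eVW {n : ℕ} {q : ℝ} {Rl Dk : ℕ → (HVW n →L[ℂ] HVW n)}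
    (hR : ∀ k (hk : k + 1 < n), KerovRuleVW n q k hk (Rl k))
    (hD : ∀ k (hk : k + 1 < n), ∀ (f : HVW n) (I J : Fin n → Sz),
      (Dk k f) (I, J) = (cq q (I ⟨k, Nat.lt_of_succ_lt hk⟩) (I ⟨k + 1, hk⟩) : ℂ) * f (I, J))
    (I J : Fin n → Sz) (j : ℕ) (hj : j < n) :
    ∃ c : ℂ, opChain Dk j (eVW I J) = c • eVW I J ∧
      opChain Rl j (eVW I J) - c • eVW I J ∈ differBefore I J j := by
  induction j with
  | zero => exact ⟨1, by simp [opChain], by simp [opChain]⟩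
  | succ j ih =>
    obtain ⟨c, hDc, hRc⟩ := ih (Nat.lt_of_succ_lt hj)
    obtain ⟨b, hb, hRb⟩ := (hR j hj).apply_eVW I J
    refine ⟨c * cq q (I ⟨j, Nat.lt_of_succ_lt hj⟩) (I ⟨j + 1, hj⟩), ?_, ?_⟩
    · rw [opChain, mul_apply_eq_comp, hDc, map_smul,
        diagonal_apply_eVW (hD j hj) I J, smul_smul]
    · have hmem : (c * b) • eVW (swapAt I ⟨j, Nat.lt_of_succ_lt hj⟩ ⟨j + 1, hj⟩) J ∈
          differBefore I J (j + 1) := by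
        by_cases h : I ⟨j, Nat.lt_of_succ_lt hj⟩ = I ⟨j + 1, hj⟩
        · simp [hb h]
        · refine Submodule.smul_mem _ _
            (eVW_mem_differBefore ⟨j, Nat.lt_of_succ_lt hj⟩ (Nat.lt_succ_self j) ?_)
          rw [swapAt_apply_left I (Fin.ne_of_val_ne (by simp))]
          exact Ne.symm h
      convert add_mem ((hR j hj).map_differBefore I J hRc) hmem using 1
      rw [opChain, mul_apply_eq_comp, map_sub, map_smul, hRb]
      module

/-- A continuous linear map annihilating all `e_{I,I}` annihilates `Ξ`. -/
theorem map_Xi_eq_zero {n : ℕ} {a : Sz → ℝ} {F : Type*} [NormedAddCommGroup F] [NormedSpace ℂ F]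
    (T : HVW n →L[ℂ] F) (hT : ∀ I, T (eVW I I) = 0) : T (Xi n a) = 0 := by
  rw [Xi]
  by_cases hs : Summable fun I : Fin n → Sz => (Real.sqrt (∏ k, a (I k)) : ℂ) • eVW I I
  · rw [T.map_tsum hs]
    simp [hT]
  · rw [tsum_eq_zero_of_not_summable hs, map_zero]

theorem inner_Xi_eVW_of_ne {n : ℕ} (a : Sz → ℝ) {K J : Fin n → Sz} (h : K ≠ J) :
    inner ℂ (Xi n a) (eVW K J) = 0 := by
  rw [inner_eq_zero_symm]
  refine map_Xi_eq_zero (innerSL ℂ (eVW K J)) fun I => ?_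
  rw [innerSL_apply_apply, eVW, lp.inner_single_left]
  have : (K, J) ≠ (I, I) := fun e => h ((congrArg Prod.fst e).trans (congrArg Prod.snd e).symm)
  simp [eVW, lp.single_apply, this]

theorem inner_Xi_of_mem_differBefore {n : ℕ} (a : Sz → ℝ) {I : Fin n → Sz} {j : ℕ} {f : HVW n}
    (hf : f ∈ differBefore I I j) : inner ℂ (Xi n a) f = 0 := by
  suffices differBefore I I j ≤ (innerSL ℂ (Xi n a)).toLinearMap.ker from this hf
  refine Submodule.span_le.2 ?_
  rintro _ ⟨K, ⟨p, -, hne⟩, rfl⟩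
  exact inner_Xi_eVW_of_ne a fun e => hne (congrFun e p)

/-!
STATEMENT 12: For `2 ≤ m ≤ n`,
`⟨R^{left}_{m−1} ∘ ⋯ ∘ R^{left}_1 Ξ, Ξ⟩ = ⟨D_{m−1} ∘ ⋯ ∘ D_1 Ξ, Ξ⟩`: in the matrix element
against Ξ each Kerov R-matrix factor may be replaced by its diagonal part.
(The operators are indexed from 0 here: `Rl k`/`Dk k` act on the 0-based positions
`k, k+1`, i.e. they are the paper's `R_{k+1}`/`D_{k+1}`; the chain `R_{m−1}⋯R_1` is
`opChain Rl (m−1)`.  Mathlib's inner product is conjugate-linear in the first variable,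
so the paper's `⟨A Ξ, Ξ⟩` is rendered as `inner Ξ (A Ξ)`.)
-/

theorem R_chain_matrix_element_eq_diagonal_chain (n : ℕ) (q : ℝ) (hq : 0 < q)
    (a : Sz → ℝ) (ha : ∀ i, 0 ≤ a i) (hsum : HasSum a 1)
    (Rl Dk : ℕ → (HVW n →L[ℂ] HVW n))
    (hR : ∀ k (hk : k + 1 < n), KerovRuleVW n q k hk (Rl k))
    (hD : ∀ k (hk : k + 1 < n), ∀ (f : HVW n) (I J : Fin n → Sz),
      (Dk k f) (I, J) = (cq q (I ⟨k, Nat.lt_of_succ_lt hk⟩) (I ⟨k + 1, hk⟩) : ℂ) * f (I, J))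
    (m : ℕ) (hm : 2 ≤ m) (hmn : m ≤ n) :
    (inner ℂ (Xi n a) (opChain Rl (m - 1) (Xi n a)) : ℂ) =
      inner ℂ (Xi n a) (opChain Dk (m - 1) (Xi n a)) := by
  rw [← sub_eq_zero, ← inner_sub_right, ← sub_apply]
  refine map_Xi_eq_zero ((innerSL ℂ (Xi n a)).comp (opChain Rl (m - 1) - opChain Dk (m - 1)))
    fun I => ?_
  obtain ⟨c, hDc, hRc⟩ := opChain_eVW hR hD I I (m - 1) (by lia)
  rw [ContinuousLinearMap.comp_apply, sub_apply, hDc]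
  exact inner_Xi_of_mem_differBefore a hRc
end
end

section
/- For m ≥ 1 set S_m := ∑_{(i_1,…,i_m) ∈ S^m} (∏_{k=1}^{m−1} c_q(i_k, i_{k+1})) ∏_{k=1}^{m} a(i_k). Then for every complex number z with |z| < min(1, q^{−1}): the power series ∑_{m≥1} S_m z^m converges absolutely, the infinite products below converge, and 1 + (q−1) ∑_{m=1}^{∞} S_m z^m = ( ∏_{i=1}^{∞} (1 + β_i q z)/(1 + β_i z) ) · ( ∏_{j=1}^{∞} (1 − α_j z)/(1 − α_j q z) ). -/
/-!
STATEMENT 16: With `S_m := ∑_{(i_1,…,i_m)∈S^m} (∏_{k=1}^{m−1} c_q(i_k,i_{k+1})) ∏_k a(i_k)`,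
for every `z ∈ ℂ` with `|z| < min(1, q⁻¹)` the power series `∑_{m≥1} S_m z^m` converges
absolutely, the infinite products converge, and
`1 + (q−1) ∑_{m≥1} S_m z^m = (∏_i (1+β_i q z)/(1+β_i z)) · (∏_j (1−α_j z)/(1−α_j q z))`.
(The sequences `α, β` are indexed here by `ℕ`, index `j` standing for the paper's `j+1`.)
-/

noncomputable section

/-- The weights `a : S → ℝ`: `a(j) = α_j` for `j > 0` and `a(−i) = β_i` for `i > 0`. -/
def aOf (α β : ℕ → ℝ) (i : Sz) : ℝ :=
  if 0 < (i : ℤ) then α ((i : ℤ).toNat - 1) else β ((-(i : ℤ)).toNat - 1)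

/-- `S_m = ∑_{(i_1,…,i_m)∈S^m} (∏_{k=1}^{m−1} c_q(i_k,i_{k+1})) ∏_{k=1}^m a(i_k)`,
the matrix element `⟨ζ_m Ξ, Ξ⟩` of the paper. -/
def Sm (q : ℝ) (α β : ℕ → ℝ) (m : ℕ) : ℝ :=
  ∑' I : Fin m → Sz,
    (∏ k : Fin (m - 1),
      cq q (I ⟨k.1, by have := k.2; omega⟩) (I ⟨k.1 + 1, by have := k.2; omega⟩))
      * ∏ k, aOf α β (I k)

open Filter Topology

/-- Total weight of the words of length `m + 1` starting at `i`, where a word has the product of the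
letter weights `a` and of the transition weights `c` as its weight. -/
def wordSum {ι : Type*} (c : ι → ι → ℝ) (a : ι → ℝ) : ℕ → ι → ℝ
  | 0, i => a i
  | m + 1, i => a i * ∑' j, c i j * wordSum c a m j

section WordSum

variable {ι : Type*} {c : ι → ι → ℝ} {a : ι → ℝ} {M : ℝ}

lemma abs_wordSum_le (ha : ∀ i, 0 ≤ a i) (hs : HasSum a 1) (hM : 0 ≤ M)
    (hc : ∀ i j, |c i j| ≤ M) (m : ℕ) (i : ι) : |wordSum c a m i| ≤ a i * M ^ m := by
  induction m generalizing i with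
  | zero => simp [wordSum, abs_of_nonneg (ha i)]
  | succ m ih =>
    have hb : HasSum (fun j => M * (a j * M ^ m)) (M ^ (m + 1)) := by
      simpa [pow_succ'] using (hs.mul_right (M ^ m)).mul_left M
    rw [wordSum, abs_mul, abs_of_nonneg (ha i)]
    refine mul_le_mul_of_nonneg_left ?_ (ha i)
    rw [← Real.norm_eq_abs]
    refine tsum_of_norm_bounded hb fun j => ?_
    rw [Real.norm_eq_abs, abs_mul]
    exact mul_le_mul (hc i j) (ih j) (abs_nonneg _) hM

lemma summable_prod_comp (ha : ∀ i, 0 ≤ a i) (hs : Summable a) (m : ℕ) :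
    Summable fun I : Fin m → ι => ∏ k, a (I k) := by
  induction m with
  | zero => exact Summable.of_finite
  | succ m ih =>
    rw [← (Fin.consEquiv fun _ : Fin (m + 1) => ι).summable_iff]
    refine (hs.mul_of_nonneg ih ha fun I => Finset.prod_nonneg fun k _ => ha _).congr fun p => ?_
    simp [Fin.consEquiv, Fin.prod_univ_succ]

lemma summable_word (ha : ∀ i, 0 ≤ a i) (hs : Summable a)
    (hc : ∀ i j, |c i j| ≤ M) {g : ι → ℝ} {C : ℝ} (hg : ∀ i, |g i| ≤ C) (m : ℕ) :
    Summable fun I : Fin (m + 1) → ι =>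
      g (I 0) * ((∏ k : Fin m, c (I k.castSucc) (I k.succ)) * ∏ k, a (I k)) := by
  refine Summable.of_norm_bounded
    ((summable_prod_comp ha hs (m + 1)).mul_left (C * M ^ m)) fun I => ?_
  have hp : 0 ≤ ∏ k, a (I k) := Finset.prod_nonneg fun k _ => ha _
  have hcM : |∏ k : Fin m, c (I k.castSucc) (I k.succ)| ≤ M ^ m := by
    rw [Finset.abs_prod]
    exact (Finset.prod_le_prod (fun _ _ => abs_nonneg _) fun k _ => hc _ _).trans_eq (by simp)
  rw [Real.norm_eq_abs, abs_mul, abs_mul, abs_of_nonneg hp, ← mul_assoc]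
  exact mul_le_mul_of_nonneg_right
    (mul_le_mul (hg _) hcM (abs_nonneg _) ((abs_nonneg _).trans (hg (I 0)))) hp

lemma tsum_word (ha : ∀ i, 0 ≤ a i) (hs : Summable a)
    (hc : ∀ i j, |c i j| ≤ M) {g : ι → ℝ} {C : ℝ} (hg : ∀ i, |g i| ≤ C) (m : ℕ) :
    ∑' I : Fin (m + 1) → ι,
      g (I 0) * ((∏ k : Fin m, c (I k.castSucc) (I k.succ)) * ∏ k, a (I k))
      = ∑' i, g i * wordSum c a m i := by
  induction m generalizing g C with
  | zero =>
    rw [← (Equiv.funUnique (Fin 1) ι).symm.tsum_eq]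
    simp [wordSum]
  | succ m ih =>
    have hsum := summable_word ha hs hc hg (m + 1)
    rw [← (Fin.consEquiv fun _ : Fin (m + 2) => ι).summable_iff] at hsum
    rw [← (Fin.consEquiv fun _ : Fin (m + 2) => ι).tsum_eq]
    refine (hsum.tsum_prod).trans (tsum_congr fun i => ?_)
    rw [wordSum, ← ih (hc i), ← mul_assoc, ← tsum_mul_left]
    refine tsum_congr fun J => ?_
    simp only [Fin.consEquiv, Function.comp_apply, Equiv.coe_fn_mk, Fin.cons_zero]
    rw [Fin.prod_univ_succ, Fin.prod_univ_succ (n := m + 1)]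
    simp only [Fin.castSucc_zero, Fin.cons_zero, Fin.cons_succ, ← Fin.succ_castSucc]
    ring

/-- Generating function, in the length, of the words starting at `i`. -/
def wordGF (c : ι → ι → ℝ) (a : ι → ℝ) (z : ℂ) (i : ι) : ℂ :=
  ∑' m : ℕ, (wordSum c a m i : ℂ) * z ^ (m + 1)

lemma norm_wordSum_mul_pow_le (ha : ∀ i, 0 ≤ a i) (hs : HasSum a 1) (hM : 0 ≤ M)
    (hc : ∀ i j, |c i j| ≤ M) (z : ℂ) (i : ι) (m : ℕ) :
    ‖(wordSum c a m i : ℂ) * z ^ (m + 1)‖ ≤ a i * (‖z‖ * (M * ‖z‖) ^ m) := by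
  rw [norm_mul, norm_pow, Complex.norm_real, Real.norm_eq_abs]
  calc _ ≤ a i * M ^ m * ‖z‖ ^ (m + 1) :=
        mul_le_mul_of_nonneg_right (abs_wordSum_le ha hs hM hc m i) (by positivity)
    _ = _ := by ring

lemma summable_uncurry_wordSum (ha : ∀ i, 0 ≤ a i) (hs : HasSum a 1) (hM : 0 ≤ M)
    (hc : ∀ i j, |c i j| ≤ M) {z : ℂ} (hz : M * ‖z‖ < 1) :
    Summable fun p : ι × ℕ => (wordSum c a p.2 p.1 : ℂ) * z ^ (p.2 + 1) := by
  refine Summable.of_norm_bounded (hs.summable.mul_of_nonneg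
    ((summable_geometric_of_lt_one (by positivity) hz).mul_left ‖z‖) ha fun m => ?_) fun p =>
      norm_wordSum_mul_pow_le ha hs hM hc z p.1 p.2
  show 0 ≤ ‖z‖ * (M * ‖z‖) ^ m
  positivity

lemma summable_wordGF (ha : ∀ i, 0 ≤ a i) (hs : HasSum a 1) (hM : 0 ≤ M)
    (hc : ∀ i j, |c i j| ≤ M) {z : ℂ} (hz : M * ‖z‖ < 1) : Summable (wordGF c a z) :=
  (summable_uncurry_wordSum ha hs hM hc hz).prod

lemma tsum_wordGF (ha : ∀ i, 0 ≤ a i) (hs : HasSum a 1) (hM : 0 ≤ M)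
    (hc : ∀ i j, |c i j| ≤ M) {z : ℂ} (hz : M * ‖z‖ < 1) :
    ∑' i, wordGF c a z i = ∑' m : ℕ, ((∑' i, wordSum c a m i : ℝ) : ℂ) * z ^ (m + 1) := by
  have h := summable_uncurry_wordSum ha hs hM hc hz
  refine (Summable.tsum_comm (f := fun i m => (wordSum c a m i : ℂ) * z ^ (m + 1)) h).symm.trans
    (tsum_congr fun m => ?_)
  rw [tsum_mul_right, Complex.ofReal_tsum]

lemma wordGF_eq (ha : ∀ i, 0 ≤ a i) (hs : HasSum a 1) (hM : 0 ≤ M)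
    (hc : ∀ i j, |c i j| ≤ M) {z : ℂ} (hz : M * ‖z‖ < 1) (i : ι) :
    wordGF c a z i = a i * z * (1 + ∑' j, (c i j : ℂ) * wordGF c a z j) := by
  have h := summable_uncurry_wordSum ha hs hM hc hz
  have hcs : Summable fun p : ι × ℕ =>
      (c i p.1 : ℂ) * ((wordSum c a p.2 p.1 : ℂ) * z ^ (p.2 + 1)) := by
    refine Summable.of_norm_bounded (h.norm.mul_left M) fun p => ?_
    rw [norm_mul, Complex.norm_real]
    exact mul_le_mul_of_nonneg_right (hc i p.1) (norm_nonneg _)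
  have hswap : ∑' j, (c i j : ℂ) * wordGF c a z j
      = ∑' m : ℕ, ((∑' j, c i j * wordSum c a m j : ℝ) : ℂ) * z ^ (m + 1) := by
    simp only [wordGF, ← tsum_mul_left]
    refine (Summable.tsum_comm (f := fun j m =>
      (c i j : ℂ) * ((wordSum c a m j : ℂ) * z ^ (m + 1))) hcs).symm.trans (tsum_congr fun m => ?_)
    rw [Complex.ofReal_tsum, ← tsum_mul_right]
    exact tsum_congr fun j => by push_cast; ring
  have hi : Summable fun m : ℕ => (wordSum c a m i : ℂ) * z ^ (m + 1) := h.prod_factor i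
  rw [hswap, wordGF, hi.tsum_eq_zero_add, mul_add, ← tsum_mul_left]
  congr 1
  · simp [wordSum]
  · refine tsum_congr fun m => ?_
    simp only [wordSum]
    push_cast
    ring

end WordSum

/-- Nonzero integers as two copies of `ℕ`: `j ↦ j + 1` and `i ↦ -(i + 1)`. -/
def szEquiv : ℕ ⊕ ℕ ≃ Sz where
  toFun := Sum.elim (fun j => ⟨(j : ℤ) + 1, by omega⟩) fun i => ⟨-((i : ℤ) + 1), by omega⟩
  invFun x := if 0 < (x : ℤ) then .inl ((x : ℤ).toNat - 1) else .inr ((-(x : ℤ)).toNat - 1)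
  left_inv x := by
    rcases x with j | i
    · simp [show (0 : ℤ) < j + 1 by omega]
    · simp
  right_inv x := by
    obtain ⟨x, hx⟩ := x
    by_cases h : 0 < x
    · simp [h]
    · simp [h]; omega

lemma aOf_inl (α β : ℕ → ℝ) (j : ℕ) : aOf α β (szEquiv (.inl j)) = α j := by
  simp [aOf, szEquiv, show (0 : ℤ) < j + 1 by omega]

lemma aOf_inr (α β : ℕ → ℝ) (i : ℕ) : aOf α β (szEquiv (.inr i)) = β i := by
  have h : ¬ (0 : ℤ) < -((i : ℤ) + 1) := by omega
  have h' : (-(-((i : ℤ) + 1))).toNat - 1 = i := by omega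
  simp only [aOf, szEquiv, Equiv.coe_fn_mk, Sum.elim_inr, if_neg h, h']

lemma hasSum_aOf {α β : ℕ → ℝ} (hαs : Summable α) (hβs : Summable β)
    (hab : ∑' j, α j + ∑' i, β i = 1) : HasSum (aOf α β) 1 := by
  rw [← szEquiv.hasSum_iff, ← hab]
  refine HasSum.sum ?_ ?_
  · simpa [Function.comp_def, aOf_inl] using hαs.hasSum
  · simpa [Function.comp_def, aOf_inr] using hβs.hasSum

lemma aOf_nonneg {α β : ℕ → ℝ} (hα : ∀ j, 0 ≤ α j) (hβ : ∀ i, 0 ≤ β i) (i : Sz) :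
    0 ≤ aOf α β i := by
  unfold aOf
  split_ifs
  exacts [hα _, hβ _]

lemma abs_cq_le {q : ℝ} (hq : 0 < q) (i j : Sz) : |cq q i j| ≤ max 1 q := by
  have h1 := le_max_left 1 q
  have h2 := le_max_right 1 q
  unfold cq
  split_ifs <;> rw [abs_le] <;> constructor <;> linarith

lemma Sm_succ_eq_tsum_wordSum {q : ℝ} (hq : 0 < q) {α β : ℕ → ℝ} (hα : ∀ j, 0 ≤ α j)
    (hβ : ∀ i, 0 ≤ β i) (hs : Summable (aOf α β)) (m : ℕ) :
    Sm q α β (m + 1) = ∑' i, wordSum (cq q) (aOf α β) m i := by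
  have h := tsum_word (aOf_nonneg hα hβ) hs (abs_cq_le hq)
    (g := fun _ => 1) (C := 1) (by simp) m
  simp only [one_mul] at h
  exact h

/-- One plus `q - 1` times the sum of `F` over the nonzero integers that are at least `n`. -/
def tailSum (q : ℝ) (F : Sz → ℂ) (n : ℤ) : ℂ :=
  1 + ((q : ℂ) - 1) * ∑' j : Sz, if n ≤ (j : ℤ) then F j else 0

section TailSum

variable {q : ℝ} {F : Sz → ℂ}

lemma summable_ite_le (hF : Summable F) (n : ℤ) :
    Summable fun j : Sz => if n ≤ (j : ℤ) then F j else 0 :=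
  Summable.of_norm_bounded hF.norm fun j => by split_ifs <;> simp

lemma tsum_ite_le_eq_add (hF : Summable F) (i : Sz) :
    ∑' j : Sz, (if (i : ℤ) ≤ j then F j else 0)
      = F i + ∑' j : Sz, if (i : ℤ) + 1 ≤ j then F j else 0 := by
  refine HasSum.tsum_eq (((hasSum_ite_eq i (F i)).add
    (summable_ite_le hF ((i : ℤ) + 1)).hasSum).congr_fun fun j => ?_)
  rcases lt_trichotomy (i : ℤ) j with h | h | h
  · simp [h.le, Subtype.ext_iff, h.ne', h]
  · simp [Subtype.ext h]
  · rw [if_neg h.not_ge, if_neg (fun e => h.ne (congrArg _ e)), if_neg (by omega), add_zero]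

lemma tsum_cq_mul (hF : Summable F) (i : Sz) :
    ∑' j, (cq q i j : ℂ) * F j
      = cq q i i * F i + (q - 1) * ∑' j : Sz, if (i : ℤ) + 1 ≤ j then F j else 0 := by
  refine HasSum.tsum_eq (((hasSum_ite_eq i (cq q i i * F i)).add
    ((summable_ite_le hF ((i : ℤ) + 1)).hasSum.mul_left ((q : ℂ) - 1))).congr_fun fun j => ?_)
  rcases lt_trichotomy (i : ℤ) j with h | h | h
  · simp [cq, Subtype.ext_iff, h.ne', h.ne, h]
  · simp [Subtype.ext h]
  · rw [if_neg (fun e => h.ne (congrArg _ e)), if_neg (by omega), cq, if_neg h.ne', if_neg h.not_gt]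
    simp

lemma tendsto_tailSum_atTop (hF : Summable F) :
    Tendsto (tailSum q F) atTop (𝓝 1) := by
  have h : Tendsto (fun n : ℤ => ∑' j : Sz, if n ≤ (j : ℤ) then F j else 0) atTop
      (𝓝 (∑' _ : Sz, 0)) := by
    refine tendsto_tsum_of_dominated_convergence hF.norm (fun j => ?_)
      (.of_forall fun n j => by split_ifs <;> simp)
    refine tendsto_const_nhds.congr' ?_
    filter_upwards [eventually_gt_atTop (j : ℤ)] with n hn
    rw [if_neg (by omega)]
  have h1 := (h.const_mul ((q : ℂ) - 1)).const_add 1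
  rwa [tsum_zero, mul_zero, add_zero] at h1

lemma tendsto_tailSum_atBot (hF : Summable F) :
    Tendsto (tailSum q F) atBot (𝓝 (1 + ((q : ℂ) - 1) * ∑' j, F j)) := by
  refine Tendsto.const_add 1 (Tendsto.const_mul _ ?_)
  refine tendsto_tsum_of_dominated_convergence hF.norm (fun j => ?_)
    (.of_forall fun n j => by split_ifs <;> simp)
  refine tendsto_const_nhds.congr' ?_
  filter_upwards [eventually_le_atBot (j : ℤ)] with n hn
  rw [if_pos hn]

lemma tailSum_zero : tailSum q F 0 = tailSum q F 1 := by
  unfold tailSum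
  congr! 5 with j
  have := j.2
  omega

end TailSum

/-- A letter `i` contributes one factor to the generating function. -/
lemma tailSum_eq_mul {q : ℝ} {F : Sz → ℂ} (hF : Summable F) {i : Sz} {w : ℂ}
    (hFi : F i = w * (1 + ∑' j, (cq q i j : ℂ) * F j)) (hd : 1 - cq q i i * w ≠ 0) :
    tailSum q F i = (1 + (q - 1) * w / (1 - cq q i i * w)) * tailSum q F (i + 1) := by
  rw [tsum_cq_mul hF] at hFi
  rw [tailSum, tailSum, tsum_ite_le_eq_add hF]
  generalize (∑' j : Sz, if (i : ℤ) + 1 ≤ j then F j else 0) = R at *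
  rw [one_add_div hd, div_mul_eq_mul_div, eq_div_iff hd]
  linear_combination ((q : ℂ) - 1) * hFi

lemma norm_one_sub_ge {M : ℝ} {d t : ℝ} {z : ℂ} (hd : |d| ≤ M) (ht0 : 0 ≤ t) (ht : t ≤ 1) :
    1 - M * ‖z‖ ≤ ‖1 - (d : ℂ) * (t * z)‖ := by
  have h : ‖(d : ℂ) * (t * z)‖ ≤ M * ‖z‖ := by
    rw [norm_mul, norm_mul, Complex.norm_real, Complex.norm_real, Real.norm_eq_abs,
      Real.norm_of_nonneg ht0]
    exact mul_le_mul hd (mul_le_of_le_one_left (norm_nonneg _) ht) (by positivity)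
      ((abs_nonneg _).trans hd)
  have := norm_sub_norm_le (1 : ℂ) ((d : ℂ) * (t * z))
  rw [norm_one] at this
  linarith

lemma one_sub_ne_zero_of_mul_norm_lt_one {M : ℝ} {d t : ℝ} {z : ℂ} (hz : M * ‖z‖ < 1)
    (hd : |d| ≤ M) (ht0 : 0 ≤ t) (ht : t ≤ 1) : 1 - (d : ℂ) * (t * z) ≠ 0 := by
  rw [← norm_pos_iff]
  linarith [norm_one_sub_ge (z := z) hd ht0 ht]

lemma multipliable_factor {M : ℝ} {d : ℝ} {z : ℂ} (hz : M * ‖z‖ < 1) (hd : |d| ≤ M) (q : ℝ)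
    {t : ℕ → ℝ} (ht0 : ∀ n, 0 ≤ t n) (ht : ∀ n, t n ≤ 1) (hts : Summable t) :
    Multipliable fun n => 1 + ((q : ℂ) - 1) * (t n * z) / (1 - d * (t n * z)) := by
  refine multipliable_one_add_of_summable ?_
  refine Summable.of_nonneg_of_le (fun _ => norm_nonneg _) (fun n => ?_)
    (hts.mul_left (‖(q : ℂ) - 1‖ * ‖z‖ / (1 - M * ‖z‖)))
  have hpos : 0 < 1 - M * ‖z‖ := by linarith
  rw [norm_div, norm_mul, norm_mul, Complex.norm_real, Real.norm_of_nonneg (ht0 n)]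
  calc _ ≤ ‖(q : ℂ) - 1‖ * (t n * ‖z‖) / (1 - M * ‖z‖) :=
        div_le_div_of_nonneg_left (mul_nonneg (norm_nonneg _) (mul_nonneg (ht0 n) (norm_nonneg _)))
          hpos (norm_one_sub_ge hd (ht0 n) (ht n))
    _ = _ := by ring

theorem generating_function_of_Sm (q : ℝ) (hq : 0 < q)
    (α β : ℕ → ℝ) (hα : ∀ j, 0 ≤ α j) (hβ : ∀ i, 0 ≤ β i)
    (hαs : Summable α) (hβs : Summable β)
    (hab : ∑' j, α j + ∑' i, β i = 1)
    (z : ℂ) (hz : ‖z‖ < min 1 q⁻¹) :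
    Summable (fun m : ℕ => ‖(Sm q α β (m + 1) : ℂ) * z ^ (m + 1)‖) ∧
    Multipliable (fun i : ℕ =>
      (1 + (β i : ℂ) * (q : ℂ) * z) / (1 + (β i : ℂ) * z)) ∧
    Multipliable (fun j : ℕ =>
      (1 - (α j : ℂ) * z) / (1 - (α j : ℂ) * (q : ℂ) * z)) ∧
    1 + ((q : ℂ) - 1) * ∑' m : ℕ, (Sm q α β (m + 1) : ℂ) * z ^ (m + 1)
      = (∏' i : ℕ, (1 + (β i : ℂ) * (q : ℂ) * z) / (1 + (β i : ℂ) * z))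
        * ∏' j : ℕ, (1 - (α j : ℂ) * z) / (1 - (α j : ℂ) * (q : ℂ) * z) := by
  have hM : 0 ≤ max 1 q := by positivity
  have hzM : max 1 q * ‖z‖ < 1 := by
    rw [lt_min_iff] at hz
    rcases max_cases 1 q with ⟨h, -⟩ | ⟨h, -⟩ <;> rw [h]
    · linarith
    · calc q * ‖z‖ < q * q⁻¹ := mul_lt_mul_of_pos_left hz.2 hq
        _ = 1 := mul_inv_cancel₀ hq.ne'
  have ha := aOf_nonneg hα hβ
  have hs := hasSum_aOf hαs hβs hab
  have hc := abs_cq_le hq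
  have ha1 : ∀ i, aOf α β i ≤ 1 := fun i => le_hasSum hs i fun j _ => ha j
  have hα1 : ∀ j, α j ≤ 1 := fun j => aOf_inl α β j ▸ ha1 _
  have hβ1 : ∀ i, β i ≤ 1 := fun i => aOf_inr α β i ▸ ha1 _
  have hdα : |q| ≤ max 1 q := by rw [abs_of_pos hq]; exact le_max_right _ _
  have hdβ : |(-1 : ℝ)| ≤ max 1 q := by simp
  have hfα : ∀ j, (1 - (α j : ℂ) * z) / (1 - (α j : ℂ) * (q : ℂ) * z)
      = 1 + ((q : ℂ) - 1) * (α j * z) / (1 - q * (α j * z)) := fun j => by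
    have h := one_sub_ne_zero_of_mul_norm_lt_one hzM hdα (hα j) (hα1 j)
    rw [show (α j : ℂ) * q * z = q * (α j * z) by ring, one_add_div h]
    congr 1
    ring
  have hfβ : ∀ i, (1 + (β i : ℂ) * (q : ℂ) * z) / (1 + (β i : ℂ) * z)
      = 1 + ((q : ℂ) - 1) * (β i * z) / (1 - (-1 : ℝ) * (β i * z)) := fun i => by
    have h := one_sub_ne_zero_of_mul_norm_lt_one hzM hdβ (hβ i) (hβ1 i)
    have h' : 1 - ((-1 : ℝ) : ℂ) * (β i * z) = 1 + β i * z := by push_cast; ring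
    rw [h'] at h ⊢
    field_simp
    ring
  have hmα := multipliable_factor hzM hdα q hα hα1 hαs
  have hmβ := multipliable_factor hzM hdβ q hβ hβ1 hβs
  set F := wordGF (cq q) (aOf α β) z with hFdef
  have hF : Summable F := summable_wordGF ha hs hM hc hzM
  have hstep (i : Sz) := tailSum_eq_mul hF (wordGF_eq ha hs hM hc hzM i)
    (one_sub_ne_zero_of_mul_norm_lt_one hzM (hc i i) (ha i) (ha1 i))
  have hSm (m : ℕ) := Sm_succ_eq_tsum_wordSum hq hα hβ hs.summable m
  simp only [hfα, hfβ]
  refine ⟨?_, hmβ, hmα, ?_⟩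
  · have h := (summable_uncurry_wordSum ha hs hM hc hzM).norm.prod_symm.prod
    refine Summable.of_nonneg_of_le (fun _ => norm_nonneg _) (fun m => ?_) h
    rw [hSm, Complex.ofReal_tsum, ← tsum_mul_right]
    exact norm_tsum_le_tsum_norm
      ((summable_uncurry_wordSum ha hs hM hc hzM).norm.prod_symm.prod_factor m)
  have hpos : ∀ n : ℕ, (∏ j ∈ Finset.range n,
      (1 + ((q : ℂ) - 1) * (α j * z) / (1 - q * (α j * z)))) * tailSum q F (n + 1)
      = tailSum q F 1 := fun n => by
    induction n with
    | zero => simp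
    | succ n ih =>
      have h := hstep (szEquiv (.inl n))
      have hcn : cq q (szEquiv (.inl n)) (szEquiv (.inl n)) = q := by
        simp [cq, szEquiv, show ¬ (n : ℤ) + 1 < 0 by omega]
      rw [aOf_inl, hcn, show ((szEquiv (.inl n) : Sz) : ℤ) = n + 1 from rfl] at h
      rw [← ih, h, Finset.prod_range_succ]
      push_cast
      ring
  have hneg : ∀ n : ℕ, tailSum q F (-n) = (∏ i ∈ Finset.range n,
      (1 + ((q : ℂ) - 1) * (β i * z) / (1 - (-1 : ℝ) * (β i * z)))) * tailSum q F 0 := fun n => by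
    induction n with
    | zero => simp
    | succ n ih =>
      have h := hstep (szEquiv (.inr n))
      have hcn : cq q (szEquiv (.inr n)) (szEquiv (.inr n)) = -1 := by
        simp only [cq, szEquiv, Equiv.coe_fn_mk, Sum.elim_inr, if_true]
        exact if_pos (by omega)
      rw [aOf_inr, hcn, show ((szEquiv (.inr n) : Sz) : ℤ) = -(n + 1) from rfl,
        show -((n : ℤ) + 1) + 1 = -n by ring, ih] at h
      rw [Finset.prod_range_succ]
      push_cast at h ⊢
      rw [h]
      ring
  have hone : ∏' j : ℕ, (1 + ((q : ℂ) - 1) * (α j * z) / (1 - q * (α j * z)))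
      = tailSum q F 1 := by
    have ht : Tendsto (fun n : ℕ => tailSum q F (n + 1)) atTop (𝓝 1) :=
      (tendsto_tailSum_atTop hF).comp
        (tendsto_atTop_add_const_right _ 1 tendsto_natCast_atTop_atTop)
    have := hmα.hasProd.tendsto_prod_nat.mul ht
    simp only [hpos, mul_one] at this
    exact tendsto_nhds_unique this tendsto_const_nhds
  have htot : ∑' m : ℕ, (Sm q α β (m + 1) : ℂ) * z ^ (m + 1) = ∑' i, F i := by
    rw [hFdef, tsum_wordGF ha hs hM hc hzM]
    simp only [hSm]
  rw [htot, hone, ← tailSum_zero]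
  refine tendsto_nhds_unique ((tendsto_tailSum_atBot hF).comp
    (tendsto_neg_atTop_atBot.comp tendsto_natCast_atTop_atTop)) ?_
  refine (hmβ.hasProd.tendsto_prod_nat.mul_const (tailSum q F 0)).congr fun n => ?_
  exact (hneg n).symm
end
end

section
/- Let α, β : {1,2,3,…} → ℝ be nonnegative with ∑_j α_j + ∑_i β_i ≤ 1, and let q > 0. For every complex z with |z| < min(1, q^{−1}), the infinite products converge, the series ∑_{k≥1} p_k(α,β)(q^k − 1) z^k / k converges absolutely, and ( ∏_{i=1}^{∞} (1 + β_i q z)/(1 + β_i z) ) · ( ∏_{j=1}^{∞} (1 − α_j z)/(1 − α_j q z) ) = exp( ∑_{k=1}^{∞} p_k(α,β) (q^k − 1) z^k / k ). -/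
/-!
STATEMENT 17: For nonnegative summable `α, β` with `∑α + ∑β ≤ 1`, `q > 0`, and `|z| <
min(1, q⁻¹)`: the infinite products converge, the series
`∑_{k≥1} p_k(α,β)(q^k−1)z^k/k` converges absolutely, and
`(∏_i (1+β_i q z)/(1+β_i z)) · (∏_j (1−α_j z)/(1−α_j q z))
   = exp(∑_{k≥1} p_k(α,β)(q^k−1)z^k/k)`,
where `p_k(α,β) = ∑_j α_j^k + (−1)^{k−1} ∑_i β_i^k` is the super-Newton sum.
(The sequences `α, β` are indexed here by `ℕ`, index `j` standing for the paper's `j+1`.)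
-/

noncomputable section

/-- The super-Newton sum `p_k(α,β) = ∑_j α_j^k + (−1)^{k−1} ∑_i β_i^k`. -/
def superNewton (α β : ℕ → ℝ) (k : ℕ) : ℝ :=
  (∑' j, α j ^ k) + (-1 : ℝ) ^ (k - 1) * ∑' i, β i ^ k

/-- Summing `-log (1 - a j * w)` over `j` agrees with summing the logarithmic series of the power
sums of `a`. -/
theorem exists_hasSum_neg_log_and_hasSum_powerSum {a : ℕ → ℝ} (ha : ∀ j, 0 ≤ a j)
    (ha1 : ∀ j, a j ≤ 1) (has : Summable a) {w : ℂ} (hw : ‖w‖ < 1) :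
    ∃ S : ℂ, HasSum (fun j => -Complex.log (1 - (a j : ℂ) * w)) S ∧
      HasSum (fun k : ℕ => ((∑' j, a j ^ (k + 1) : ℝ) : ℂ) * w ^ (k + 1) / (k + 1)) S := by
  have hgeom : Summable (fun k : ℕ => ‖w‖ ^ (k + 1)) :=
    (summable_nat_add_iff 1).2 (summable_geometric_of_lt_one (norm_nonneg w) hw)
  have hpow : ∀ j (k : ℕ), a j ^ (k + 1) ≤ a j := fun j k =>
    pow_le_of_le_one (ha j) (ha1 j) k.succ_ne_zero
  have hsum : Summable (fun p : ℕ × ℕ =>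
      ((a p.1 : ℂ) * w) ^ (p.2 + 1) / ((p.2 : ℂ) + 1)) := by
    refine Summable.of_norm_bounded
      (has.mul_of_nonneg hgeom ha fun k => pow_nonneg (norm_nonneg w) _) ?_
    rintro ⟨j, k⟩
    have hk : ‖(k : ℂ) + 1‖ = (k : ℝ) + 1 := by
      exact_mod_cast Complex.norm_natCast (k + 1)
    rw [norm_div, hk, norm_pow, norm_mul, Complex.norm_real, Real.norm_of_nonneg (ha j), mul_pow]
    exact (div_le_self (mul_nonneg (pow_nonneg (ha j) _) (by positivity)) (by simp)).trans
      (mul_le_mul_of_nonneg_right (hpow j k) (by positivity))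
  refine ⟨_, hsum.hasSum.prod_fiberwise fun j => ?_,
    ((Equiv.prodComm ℕ ℕ).hasSum_iff.2 hsum.hasSum).prod_fiberwise fun k => ?_⟩
  · have hj : ‖(a j : ℂ) * w‖ < 1 := by
      rw [norm_mul, Complex.norm_real, Real.norm_of_nonneg (ha j)]
      exact (mul_le_of_le_one_left (norm_nonneg w) (ha1 j)).trans_lt hw
    simpa using (hasSum_nat_add_iff' 1).2 (Complex.hasSum_taylorSeries_neg_log hj)
  · have hk : Summable (fun j => a j ^ (k + 1)) :=
      Summable.of_nonneg_of_le (fun j => pow_nonneg (ha j) _) (fun j => hpow j k) has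
    simpa [mul_pow, mul_div_assoc] using
      (Complex.hasSum_ofReal.2 hk.hasSum).mul_right (w ^ (k + 1) / ((k : ℂ) + 1))

theorem one_sub_ofReal_mul_ne_zero {t : ℝ} (ht : 0 ≤ t) (ht1 : t ≤ 1) {w : ℂ} (hw : ‖w‖ < 1) :
    1 - (t : ℂ) * w ≠ 0 := by
  intro h
  have hn : ‖(t : ℂ) * w‖ = 1 := by rw [← sub_eq_zero.1 h, norm_one]
  rw [norm_mul, Complex.norm_real, Real.norm_of_nonneg ht] at hn
  exact absurd hn ((mul_le_of_le_one_left (norm_nonneg w) ht1).trans_lt hw).ne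

/-- A product of quotients `(1 - a j * w) / (1 - a j * v)` from the sums of the logarithms. -/
theorem hasProd_div_of_hasSum_neg_log {a : ℕ → ℝ} (ha : ∀ j, 0 ≤ a j) (ha1 : ∀ j, a j ≤ 1)
    {v w S T : ℂ} (hv : ‖v‖ < 1) (hw : ‖w‖ < 1)
    (hS : HasSum (fun j => -Complex.log (1 - (a j : ℂ) * v)) S)
    (hT : HasSum (fun j => -Complex.log (1 - (a j : ℂ) * w)) T) :
    HasProd (fun j => (1 - (a j : ℂ) * w) / (1 - (a j : ℂ) * v)) (Complex.exp (S - T)) := by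
  convert! (hS.sub hT).cexp using 2 with j
  simp only [Function.comp_apply]
  rw [neg_sub_neg, Complex.exp_sub,
    Complex.exp_log (one_sub_ofReal_mul_ne_zero (ha j) (ha1 j) hw),
    Complex.exp_log (one_sub_ofReal_mul_ne_zero (ha j) (ha1 j) hv)]

theorem products_eq_exp_superNewton_series (q : ℝ) (hq : 0 < q)
    (α β : ℕ → ℝ) (hα : ∀ j, 0 ≤ α j) (hβ : ∀ i, 0 ≤ β i)
    (hαs : Summable α) (hβs : Summable β)
    (hab : ∑' j, α j + ∑' i, β i ≤ 1)
    (z : ℂ) (hz : ‖z‖ < min 1 q⁻¹) :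
    Multipliable (fun i : ℕ =>
      (1 + (β i : ℂ) * (q : ℂ) * z) / (1 + (β i : ℂ) * z)) ∧
    Multipliable (fun j : ℕ =>
      (1 - (α j : ℂ) * z) / (1 - (α j : ℂ) * (q : ℂ) * z)) ∧
    Summable (fun k : ℕ =>
      ‖(superNewton α β (k + 1) : ℂ) * ((q : ℂ) ^ (k + 1) - 1) * z ^ (k + 1) / (k + 1)‖) ∧
    (∏' i : ℕ, (1 + (β i : ℂ) * (q : ℂ) * z) / (1 + (β i : ℂ) * z))
        * (∏' j : ℕ, (1 - (α j : ℂ) * z) / (1 - (α j : ℂ) * (q : ℂ) * z))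
      = Complex.exp (∑' k : ℕ,
          (superNewton α β (k + 1) : ℂ) * ((q : ℂ) ^ (k + 1) - 1) * z ^ (k + 1) / (k + 1)) := by
  have hz1 : ‖z‖ < 1 := hz.trans_le (min_le_left _ _)
  have hqz : ‖(q : ℂ) * z‖ < 1 := by
    rw [norm_mul, Complex.norm_real, Real.norm_of_nonneg hq.le]
    calc q * ‖z‖ < q * q⁻¹ := mul_lt_mul_of_pos_left (hz.trans_le (min_le_right _ _)) hq
      _ = 1 := mul_inv_cancel₀ hq.ne'
  have hz1' : ‖-z‖ < 1 := by rwa [norm_neg]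
  have hqz' : ‖-((q : ℂ) * z)‖ < 1 := by rwa [norm_neg]
  have hα1 : ∀ j, α j ≤ 1 := fun j => by
    linarith [hαs.le_tsum j fun i _ => hα i, (tsum_nonneg hβ : 0 ≤ ∑' i, β i)]
  have hβ1 : ∀ i, β i ≤ 1 := fun i => by
    linarith [hβs.le_tsum i fun j _ => hβ j, (tsum_nonneg hα : 0 ≤ ∑' j, α j)]
  obtain ⟨A, hA, hA'⟩ := exists_hasSum_neg_log_and_hasSum_powerSum hα hα1 hαs hz1
  obtain ⟨Aq, hAq, hAq'⟩ := exists_hasSum_neg_log_and_hasSum_powerSum hα hα1 hαs hqz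
  obtain ⟨B, hB, hB'⟩ := exists_hasSum_neg_log_and_hasSum_powerSum hβ hβ1 hβs hz1'
  obtain ⟨Bq, hBq, hBq'⟩ := exists_hasSum_neg_log_and_hasSum_powerSum hβ hβ1 hβs hqz'
  have hprodα := hasProd_div_of_hasSum_neg_log hα hα1 hqz hz1 hAq hA
  have hprodβ := hasProd_div_of_hasSum_neg_log hβ hβ1 hz1' hqz' hB hBq
  simp only [mul_neg, sub_neg_eq_add, ← mul_assoc] at hprodα hprodβ
  have hseries : HasSum (fun k : ℕ =>
      (superNewton α β (k + 1) : ℂ) * ((q : ℂ) ^ (k + 1) - 1) * z ^ (k + 1) / (k + 1))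
      ((B - Bq) + (Aq - A)) := by
    convert! (hB'.sub hBq').add (hAq'.sub hA') using 2 with k
    rw [superNewton, neg_pow z, neg_pow ((q : ℂ) * z), mul_pow, Nat.add_sub_cancel]
    push_cast
    ring
  refine ⟨hprodβ.multipliable, hprodα.multipliable, hseries.summable.norm, ?_⟩
  rw [hprodβ.tprod_eq, hprodα.tprod_eq, hseries.tsum_eq, Complex.exp_add]
end
end
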